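/- Let q be a squarefree positive integer written as q = c₁·d₁ with c₁, d₁ positive, and let α, β, s be complex numbers with Re s > 1 + max(0, Re α, Re β, Re(α+β)). Then ∑_{n = 1}^{∞} σ_β(n; χ_q) · σ_α(n) · n^{−s} · ∏_{p ∣ c₁} [ σ_β(n_p) (1 − p^{β−1}) − 1 ] = [ ζ(s) ζ(s−β) ζ(s−α) ζ(s−β−α) / ζ(2s−β−α) ] · ∏_{p ∣ q} (1 − p^{−(2s−β−α)})^{−1} · ∏_{p ∣ d₁} (1 − p^{−(s−β)}) (1 − p^{−(s−β−α)}) · ∏_{p ∣ c₁} [ (1 − p^{β−1}) (1 − p^{−(2s−β−α)}) − (1 − p^{−(s−β)}) (1 − p^{−(s−β−α)}) ], where p runs over primes. -/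

import Mathlib

open Complex

/-- The generalized divisor function `σ_α(n) = ∑_{d ∣ n} d^α` with complex exponent. -/
noncomputable def sigmaC (α : ℂ) (n : ℕ) : ℂ := ∑ d ∈ n.divisors, (d : ℂ) ^ α

/-- The divisor function twisted by the principal character mod `q`:
`σ_α(n; χ_q) = ∑_{d ∣ n, (d,q)=1} d^α`. -/
noncomputable def sigmaTwisted (α : ℂ) (n q : ℕ) : ℂ :=
  ∑ d ∈ n.divisors.filter (fun d => Nat.gcd d q = 1), (d : ℂ) ^ α

open scoped ArithmeticFunction.zeta in
theorem sum_divisors_mul_of_coprime {h : ℕ → ℂ} (h1 : h 1 = 1)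
    (hmul : ∀ {m n : ℕ}, m.Coprime n → h (m * n) = h m * h n) {m n : ℕ} (hmn : m.Coprime n) :
    ∑ d ∈ (m * n).divisors, h d = (∑ d ∈ m.divisors, h d) * ∑ d ∈ n.divisors, h d := by
  let f : ArithmeticFunction ℂ := ⟨fun d => if d = 0 then 0 else h d, if_pos rfl⟩
  have hf : f.IsMultiplicative := by
    rw [ArithmeticFunction.IsMultiplicative.iff_ne_zero]
    refine ⟨by simp [f, h1], fun {m n} hm hn hmn => ?_⟩
    simp [f, hm, hn, hmul hmn]
  have key (k : ℕ) : ((ζ : ArithmeticFunction ℂ) * f) k = ∑ d ∈ k.divisors, h d := by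
    rw [ArithmeticFunction.coe_zeta_mul_apply]
    exact Finset.sum_congr rfl fun d hd => if_neg (Nat.pos_of_mem_divisors hd).ne'
  simp only [← key]
  exact (ArithmeticFunction.isMultiplicative_zeta.natCast.mul hf).map_mul_of_coprime hmn

theorem sigmaC_one (α : ℂ) : sigmaC α 1 = 1 := by simp [sigmaC]

theorem sigmaC_mul_of_coprime (α : ℂ) {m n : ℕ} (hmn : m.Coprime n) :
    sigmaC α (m * n) = sigmaC α m * sigmaC α n :=
  sum_divisors_mul_of_coprime (by simp)
    (fun {m n} _ => by rw [Nat.cast_mul, natCast_mul_natCast_cpow]) hmn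

theorem sigmaTwisted_eq_sum_ite (α : ℂ) (n q : ℕ) :
    sigmaTwisted α n q = ∑ d ∈ n.divisors, if Nat.gcd d q = 1 then (d : ℂ) ^ α else 0 :=
  Finset.sum_filter _ _

theorem sigmaTwisted_one (α : ℂ) (q : ℕ) : sigmaTwisted α 1 q = 1 := by
  simp [sigmaTwisted_eq_sum_ite]

theorem sigmaTwisted_mul_of_coprime (α : ℂ) (q : ℕ) {m n : ℕ} (hmn : m.Coprime n) :
    sigmaTwisted α (m * n) q = sigmaTwisted α m q * sigmaTwisted α n q := by
  simp only [sigmaTwisted_eq_sum_ite]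
  refine sum_divisors_mul_of_coprime (by simp) (fun {m n} _ => ?_) hmn
  have := Nat.coprime_mul_iff_left (m := m) (n := n) (k := q)
  simp only [Nat.Coprime] at this
  simp only [this, Nat.cast_mul, natCast_mul_natCast_cpow]
  split_ifs <;> simp_all

theorem natCast_pow_cpow (p k : ℕ) (α : ℂ) : ((p ^ k : ℕ) : ℂ) ^ α = ((p : ℂ) ^ α) ^ k := by
  induction k with
  | zero => simp
  | succ k ih => rw [pow_succ, Nat.cast_mul, natCast_mul_natCast_cpow, ih, pow_succ]

theorem sigmaC_prime_pow (α : ℂ) {p : ℕ} (hp : p.Prime) (e : ℕ) :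
    sigmaC α (p ^ e) = ∑ k ∈ Finset.range (e + 1), ((p : ℂ) ^ α) ^ k := by
  simp only [sigmaC, Nat.sum_divisors_prime_pow hp, natCast_pow_cpow]

theorem sigmaTwisted_prime_pow_of_not_dvd (α : ℂ) {p q : ℕ} (hp : p.Prime) (hpq : ¬ p ∣ q)
    (e : ℕ) : sigmaTwisted α (p ^ e) q = sigmaC α (p ^ e) := by
  rw [sigmaTwisted_eq_sum_ite, sigmaC, Nat.sum_divisors_prime_pow hp, Nat.sum_divisors_prime_pow hp]
  refine Finset.sum_congr rfl fun k _ => if_pos ?_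
  exact Nat.Coprime.pow_left k ((Nat.Prime.coprime_iff_not_dvd hp).2 hpq)

theorem sigmaTwisted_prime_pow_of_dvd (α : ℂ) {p q : ℕ} (hp : p.Prime) (hpq : p ∣ q)
    (e : ℕ) : sigmaTwisted α (p ^ e) q = 1 := by
  rw [sigmaTwisted_eq_sum_ite, Nat.sum_divisors_prime_pow hp, Finset.sum_range_succ',
    Finset.sum_eq_zero]
  · simp
  · intro k _
    refine if_neg fun h => hp.one_lt.ne' ?_
    exact Nat.eq_one_of_dvd_coprimes h (dvd_pow_self p k.succ_ne_zero) hpq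

theorem norm_geom_sum_le {a : ℂ} {A : ℝ} (ha : ‖a‖ ≤ A) (hA : 1 ≤ A) (e : ℕ) :
    ‖∑ k ∈ Finset.range (e + 1), a ^ k‖ ≤ (e + 1) * A ^ e := by
  refine (norm_sum_le_of_le (n := fun _ => A ^ e) _ fun k hk => ?_).trans_eq (by simp)
  rw [norm_pow]
  exact (pow_le_pow_left₀ (norm_nonneg a) ha k).trans
    (pow_le_pow_right₀ hA (Nat.lt_succ_iff.1 (Finset.mem_range.1 hk)))

theorem summable_sq_mul_pow {r : ℝ} (h0 : 0 ≤ r) (h1 : r < 1) :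
    Summable fun e : ℕ => ((e : ℝ) + 1) ^ 2 * r ^ e := by
  have hr : ‖r‖ < 1 := by rwa [Real.norm_of_nonneg h0]
  have s2 := summable_pow_mul_geometric_of_norm_lt_one 2 hr
  have s1 := (summable_pow_mul_geometric_of_norm_lt_one 1 hr).mul_left 2
  have s0 := summable_geometric_of_norm_lt_one hr
  refine ((s2.add s1).add s0).congr fun e => ?_
  ring

theorem summable_geom_sum_mul_geom_sum {a b x : ℂ} {A B : ℝ} (ha : ‖a‖ ≤ A) (hb : ‖b‖ ≤ B)
    (hA : 1 ≤ A) (hB : 1 ≤ B) (hx : A * B * ‖x‖ < 1) :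
    Summable fun e : ℕ => (∑ k ∈ Finset.range (e + 1), a ^ k) *
      (∑ k ∈ Finset.range (e + 1), b ^ k) * x ^ e := by
  refine .of_norm_bounded (summable_sq_mul_pow (r := A * B * ‖x‖) (by positivity) hx) fun e => ?_
  rw [norm_mul, norm_mul, norm_pow]
  calc _ ≤ ((e + 1) * A ^ e) * ((e + 1) * B ^ e) * ‖x‖ ^ e := by
        gcongr
        · exact norm_geom_sum_le ha hA e
        · exact norm_geom_sum_le hb hB e
    _ = _ := by rw [mul_pow, mul_pow]; ring

theorem one_sub_ne_zero_of_norm_lt_one {z : ℂ} (hz : ‖z‖ < 1) : 1 - z ≠ 0 := by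
  intro h
  rw [← sub_eq_zero.1 h] at hz
  simp at hz

theorem hasSum_geom_sum_mul_pow {a x : ℂ} {A : ℝ} (ha : ‖a‖ ≤ A) (hA : 1 ≤ A)
    (hx : A * ‖x‖ < 1) :
    HasSum (fun e : ℕ => (∑ k ∈ Finset.range (e + 1), a ^ k) * x ^ e)
      ((1 - x)⁻¹ * (1 - a * x)⁻¹) := by
  have hx1 : ‖x‖ < 1 := (le_mul_of_one_le_left (norm_nonneg x) hA).trans_lt hx
  have hax : ‖a * x‖ < 1 := by
    rw [norm_mul]
    exact (by gcongr : ‖a‖ * ‖x‖ ≤ A * ‖x‖).trans_lt hx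
  have hs : Summable fun e : ℕ => (∑ k ∈ Finset.range (e + 1), a ^ k) * x ^ e := by
    refine (summable_geom_sum_mul_geom_sum (b := 0) (B := 1) ha (by simp) hA le_rfl
      (by simpa using hx)).congr fun e => ?_
    simp [Finset.sum_range_succ']
  convert hs.hasSum using 1
  have hrec := hs.tsum_eq_zero_add
  have : ∀ e : ℕ, (∑ k ∈ Finset.range (e + 1 + 1), a ^ k) * x ^ (e + 1) =
      x * x ^ e + a * x * ((∑ k ∈ Finset.range (e + 1), a ^ k) * x ^ e) := fun e => by
    rw [geom_sum_succ]; ring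
  simp only [this] at hrec
  rw [((summable_geometric_of_norm_lt_one hx1).mul_left x).tsum_add (hs.mul_left (a * x)),
    tsum_mul_left, tsum_mul_left, tsum_geometric_of_norm_lt_one hx1] at hrec
  have h1 := one_sub_ne_zero_of_norm_lt_one hx1
  have h2 := one_sub_ne_zero_of_norm_lt_one hax
  generalize (∑' e : ℕ, (∑ k ∈ Finset.range (e + 1), a ^ k) * x ^ e) = U at hrec
  simp at hrec
  have hrec' : U * (1 - a * x) = 1 + x * (1 - x)⁻¹ := by linear_combination hrec
  rw [← eq_div_iff h2] at hrec'
  rw [hrec']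
  field_simp
  ring

theorem hasSum_geom_sum_mul_geom_sum_mul_pow {a b x : ℂ} {A B : ℝ} (ha : ‖a‖ ≤ A)
    (hb : ‖b‖ ≤ B) (hA : 1 ≤ A) (hB : 1 ≤ B) (hx : A * B * ‖x‖ < 1) :
    HasSum (fun e : ℕ => (∑ k ∈ Finset.range (e + 1), a ^ k) *
        (∑ k ∈ Finset.range (e + 1), b ^ k) * x ^ e)
      ((1 - a * b * x ^ 2) *
        ((1 - x)⁻¹ * (1 - a * x)⁻¹ * (1 - b * x)⁻¹ * (1 - a * b * x)⁻¹)) := by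
  have hxA : A * ‖x‖ < 1 := lt_of_le_of_lt (by
    gcongr; exact le_mul_of_one_le_right (by positivity) hB) hx
  have hxB : B * ‖x‖ < 1 := lt_of_le_of_lt (by
    gcongr; exact le_mul_of_one_le_left (by positivity) hA) hx
  have hx1 : ‖x‖ < 1 := (le_mul_of_one_le_left (norm_nonneg x) hA).trans_lt hxA
  have hax : ‖a * x‖ < 1 := by
    rw [norm_mul]
    exact (by gcongr : ‖a‖ * ‖x‖ ≤ A * ‖x‖).trans_lt hxA
  have hbx : ‖b * x‖ < 1 := by
    rw [norm_mul]
    exact (by gcongr : ‖b‖ * ‖x‖ ≤ B * ‖x‖).trans_lt hxB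
  have habx : ‖a * b * x‖ < 1 := by
    rw [norm_mul, norm_mul]
    exact (by gcongr : ‖a‖ * ‖b‖ * ‖x‖ ≤ A * B * ‖x‖).trans_lt hx
  have hs := summable_geom_sum_mul_geom_sum ha hb hA hB hx
  have hU := hasSum_geom_sum_mul_pow ha hA hxA
  have hV := hasSum_geom_sum_mul_pow hb hB hxB
  have hG := hasSum_geometric_of_norm_lt_one hx1
  convert hs.hasSum using 1
  have hrec := hs.tsum_eq_zero_add
  have hterm : ∀ e : ℕ, (∑ k ∈ Finset.range (e + 1 + 1), a ^ k) *
      (∑ k ∈ Finset.range (e + 1 + 1), b ^ k) * x ^ (e + 1) =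
      x * x ^ e + a * x * ((∑ k ∈ Finset.range (e + 1), a ^ k) * x ^ e) +
      b * x * ((∑ k ∈ Finset.range (e + 1), b ^ k) * x ^ e) +
      a * b * x * ((∑ k ∈ Finset.range (e + 1), a ^ k) *
        (∑ k ∈ Finset.range (e + 1), b ^ k) * x ^ e) := fun e => by
    rw [geom_sum_succ, geom_sum_succ (x := b)]; ring
  simp only [hterm] at hrec
  rw [((((hG.mul_left x).add (hU.mul_left (a * x))).add (hV.mul_left (b * x))).add
    (hs.hasSum.mul_left (a * b * x))).tsum_eq] at hrec
  have h1 := one_sub_ne_zero_of_norm_lt_one hx1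
  have h2 := one_sub_ne_zero_of_norm_lt_one hax
  have h3 := one_sub_ne_zero_of_norm_lt_one hbx
  have h4 := one_sub_ne_zero_of_norm_lt_one habx
  generalize (∑' e : ℕ, (∑ k ∈ Finset.range (e + 1), a ^ k) *
    (∑ k ∈ Finset.range (e + 1), b ^ k) * x ^ e) = U at hrec
  simp at hrec
  have hrec' : U * (1 - a * b * x) = 1 + (x * (1 - x)⁻¹ + a * x * ((1 - x)⁻¹ * (1 - a * x)⁻¹) +
    b * x * ((1 - x)⁻¹ * (1 - b * x)⁻¹)) := by linear_combination hrec
  rw [← eq_div_iff h4] at hrec'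
  rw [hrec']
  field_simp
  ring

theorem exists_sq_mul_pow_le {r : ℝ} (h0 : 0 ≤ r) (h1 : r < 1) (K : ℝ) :
    ∃ C : ℝ, 1 ≤ C ∧ ∀ e : ℕ, K * ((e : ℝ) + 1) ^ 2 * r ^ e ≤ C := by
  have hs := summable_sq_mul_pow h0 h1
  refine ⟨|K| * (∑' e : ℕ, ((e : ℝ) + 1) ^ 2 * r ^ e) + 1, ?_, fun e => ?_⟩
  · have : 0 ≤ ∑' e : ℕ, ((e : ℝ) + 1) ^ 2 * r ^ e := tsum_nonneg fun e => by positivity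
    have : 0 ≤ |K| * ∑' e : ℕ, ((e : ℝ) + 1) ^ 2 * r ^ e := by positivity
    linarith
  · have h2 := hs.le_tsum e fun j _ => by positivity
    have h3 : K * (((e : ℝ) + 1) ^ 2 * r ^ e) ≤ |K| * (((e : ℝ) + 1) ^ 2 * r ^ e) := by
      gcongr; exact le_abs_self K
    have h4 := mul_le_mul_of_nonneg_left h2 (abs_nonneg K)
    rw [mul_assoc]
    linarith

theorem sq_mul_pow_le_one {r : ℝ} (h0 : 0 ≤ r) (hr : r ≤ 1 / 4) (e : ℕ) :
    ((e : ℝ) + 1) ^ 2 * r ^ e ≤ 1 := by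
  have h2 : (e : ℝ) + 1 ≤ 2 ^ e := by exact_mod_cast Nat.lt_two_pow_self
  calc ((e : ℝ) + 1) ^ 2 * r ^ e ≤ (2 ^ e) ^ 2 * (1 / 4) ^ e := by gcongr
    _ = 1 := by rw [← pow_mul, mul_comm e, pow_mul, ← mul_pow]; norm_num

theorem summable_norm_of_prime_pow_le {g : ℕ → ℂ} (g0 : g 0 = 0) (g1 : g 1 = 1)
    (gmul : ∀ m n : ℕ, m.Coprime n → g (m * n) = g m * g n) {t : ℝ} (ht : 1 < t) {K : ℕ → ℝ}
    {S : Finset ℕ} (hK : ∀ p ∉ S, K p ≤ 1)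
    (hg : ∀ p : ℕ, p.Prime → ∀ e : ℕ,
      ‖g (p ^ e)‖ ≤ K p * ((e : ℝ) + 1) ^ 2 * ((p : ℝ) ^ (-t)) ^ e) :
    Summable (‖g ·‖) := by
  obtain ⟨u, hu1, hut⟩ := exists_between ht
  have hδ : 0 < t - u := sub_pos.2 hut
  have hlim : Filter.Tendsto (fun p : ℕ => (p : ℝ) ^ (-(t - u))) Filter.atTop (nhds 0) :=
    (tendsto_rpow_neg_atTop hδ).comp tendsto_natCast_atTop_atTop
  obtain ⟨N, hN⟩ := Filter.eventually_atTop.1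
    (hlim.eventually_le_const (by norm_num : (0 : ℝ) < 1 / 4))
  let T := S ∪ Finset.range N
  have hC (p : ℕ) : ∃ C : ℝ, 1 ≤ C ∧ (p ∉ T → C = 1) ∧
      (p.Prime → ∀ e : ℕ, K p * ((e : ℝ) + 1) ^ 2 * ((p : ℝ) ^ (-(t - u))) ^ e ≤ C) := by
    by_cases hp : p.Prime
    · have h0 : (0 : ℝ) ≤ (p : ℝ) ^ (-(t - u)) := by positivity
      by_cases hT : p ∈ T
      · obtain ⟨C, h, h'⟩ := exists_sq_mul_pow_le h0
          (Real.rpow_lt_one_of_one_lt_of_neg (by exact_mod_cast hp.one_lt)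
            (neg_neg_of_pos hδ)) (K p)
        exact ⟨C, h, fun h => absurd hT h, fun _ => h'⟩
      · refine ⟨1, le_rfl, fun _ => rfl, fun _ e => ?_⟩
        simp only [T, Finset.mem_union, Finset.mem_range, not_or, not_lt] at hT
        rw [mul_assoc]
        exact (mul_le_mul_of_nonneg_right (hK p hT.1) (by positivity)).trans
          ((one_mul _).trans_le (sq_mul_pow_le_one h0 (hN p hT.2) e))
    · exact ⟨1, le_rfl, fun _ => rfl, fun h => absurd h hp⟩
  choose C hC1 hCT hCK using hC
  refine .of_norm_bounded (((Real.summable_nat_rpow (p := -u)).2 (by linarith)).mul_left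
    (∏ p ∈ T, C p)) fun n => ?_
  have hC0 (p : ℕ) : 0 ≤ C p := zero_le_one.trans (hC1 p)
  rcases eq_or_ne n 0 with rfl | hn
  · rw [g0, norm_zero, norm_zero]
    exact mul_nonneg (Finset.prod_nonneg fun p _ => hC0 p) (by positivity)
  have hn_rpow : (n : ℝ) ^ (-u) = ∏ p ∈ n.primeFactors, ((p : ℝ) ^ (-u)) ^ n.factorization p := by
    conv_lhs => rw [← Nat.prod_factorization_pow_eq_self hn]
    rw [Finsupp.prod, Nat.support_factorization, Nat.cast_prod,
      ← Real.finsetProd_rpow _ _ fun p _ => by positivity]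
    refine Finset.prod_congr rfl fun p _ => ?_
    rw [Nat.cast_pow, ← Real.rpow_natCast, ← Real.rpow_mul p.cast_nonneg,
      ← Real.rpow_mul_natCast p.cast_nonneg, mul_comm]
  have hprod : ∏ p ∈ n.primeFactors, C p ≤ ∏ p ∈ T, C p := by
    have h1 : ∏ p ∈ n.primeFactors ∩ T, C p = ∏ p ∈ n.primeFactors, C p :=
      Finset.prod_subset Finset.inter_subset_left fun p hp hp' =>
        hCT p fun h => hp' (Finset.mem_inter.2 ⟨hp, h⟩)
    rw [← h1, ← Finset.prod_sdiff (Finset.inter_subset_right : n.primeFactors ∩ T ⊆ T)]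
    exact le_mul_of_one_le_left (Finset.prod_nonneg fun p _ => hC0 p)
      (Finset.one_le_prod fun p _ => hC1 p)
  rw [norm_norm, Nat.multiplicative_factorization g gmul g1 hn, Finsupp.prod, norm_prod,
    Nat.support_factorization]
  calc ∏ p ∈ n.primeFactors, ‖g (p ^ n.factorization p)‖
      ≤ ∏ p ∈ n.primeFactors, C p * ((p : ℝ) ^ (-u)) ^ n.factorization p := by
        refine Finset.prod_le_prod (fun _ _ => norm_nonneg _) fun p hp => ?_
        have hpp := Nat.prime_of_mem_primeFactors hp
        have hsplit : (p : ℝ) ^ (-t) = (p : ℝ) ^ (-(t - u)) * (p : ℝ) ^ (-u) := by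
          rw [← Real.rpow_add (by exact_mod_cast hpp.pos)]
          ring_nf
        refine (hg p hpp _).trans ?_
        rw [hsplit, mul_pow, ← mul_assoc]
        exact mul_le_mul_of_nonneg_right (hCK p hpp _) (by positivity)
    _ = (∏ p ∈ n.primeFactors, C p) * (n : ℝ) ^ (-u) := by
        rw [Finset.prod_mul_distrib, hn_rpow]
    _ ≤ _ := mul_le_mul_of_nonneg_right hprod (by positivity)

/-- The product `∏_{p ∣ c} (σ_β(n_p)(1-p^{β-1}) - 1)`, normalized to take the value `1` at
`n = 1`. -/
noncomputable def levelFactor (β : ℂ) (c n : ℕ) : ℂ :=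
  ∏ p ∈ c.primeFactors,
    (sigmaC β (p ^ n.factorization p) * (1 - (p : ℂ) ^ (β - 1)) - 1) / (-(p : ℂ) ^ (β - 1))

theorem natCast_prime_cpow_ne_zero {p : ℕ} (hp : p.Prime) (z : ℂ) : (p : ℂ) ^ z ≠ 0 := by
  simp [cpow_eq_zero_iff, hp.ne_zero]

theorem levelFactor_local_one {p : ℕ} (hp : p.Prime) (β : ℂ) :
    (sigmaC β (p ^ 0) * (1 - (p : ℂ) ^ (β - 1)) - 1) / (-(p : ℂ) ^ (β - 1)) = 1 := by
  rw [pow_zero, sigmaC_one, one_mul, sub_sub_cancel_left,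
    div_self (neg_ne_zero.2 (natCast_prime_cpow_ne_zero hp _))]

theorem levelFactor_one (β : ℂ) (c : ℕ) : levelFactor β c 1 = 1 := by
  refine Finset.prod_eq_one fun p hp => ?_
  rw [Nat.factorization_one]
  exact levelFactor_local_one (Nat.prime_of_mem_primeFactors hp) β

theorem levelFactor_mul_of_coprime (β : ℂ) (c : ℕ) {m n : ℕ} (hmn : m.Coprime n) :
    levelFactor β c (m * n) = levelFactor β c m * levelFactor β c n := by
  rw [levelFactor, levelFactor, levelFactor, ← Finset.prod_mul_distrib]
  refine Finset.prod_congr rfl fun p hp => ?_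
  have hp := Nat.prime_of_mem_primeFactors hp
  rw [Nat.factorization_mul_apply_of_coprime hmn]
  by_cases hpm : p ∣ m
  · have hpn : n.factorization p = 0 :=
      Nat.factorization_eq_zero_of_not_dvd fun hpn => Nat.not_coprime_of_dvd_of_dvd
        hp.one_lt hpm hpn hmn
    rw [hpn, levelFactor_local_one hp, mul_one, add_zero]
  · rw [Nat.factorization_eq_zero_of_not_dvd hpm, levelFactor_local_one hp, one_mul, zero_add]

theorem levelFactor_prime_pow_of_not_dvd (β : ℂ) {c p : ℕ} (hp : p.Prime) (hpc : ¬ p ∣ c)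
    (e : ℕ) : levelFactor β c (p ^ e) = 1 := by
  refine Finset.prod_eq_one fun r hr => ?_
  have hrp : r ≠ p := fun h => hpc (h ▸ Nat.dvd_of_mem_primeFactors hr)
  rw [hp.factorization_pow, Finsupp.single_eq_of_ne hrp]
  exact levelFactor_local_one (Nat.prime_of_mem_primeFactors hr) β

theorem levelFactor_prime_pow_of_dvd (β : ℂ) {c p : ℕ} (hc : c ≠ 0) (hp : p.Prime) (hpc : p ∣ c)
    (e : ℕ) : levelFactor β c (p ^ e) =
      (sigmaC β (p ^ e) * (1 - (p : ℂ) ^ (β - 1)) - 1) / (-(p : ℂ) ^ (β - 1)) := by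
  rw [levelFactor, Finset.prod_eq_single_of_mem p (Nat.mem_primeFactors.2 ⟨hp, hpc, hc⟩)]
  · rw [hp.factorization_pow, Finsupp.single_eq_same]
  · intro r hr hrp
    rw [hp.factorization_pow, Finsupp.single_eq_of_ne hrp]
    exact levelFactor_local_one (Nat.prime_of_mem_primeFactors hr) β

/-- The summand of the Dirichlet series, normalized to take the value `1` at `n = 1`. -/
noncomputable def normalizedTerm (q c : ℕ) (α β s : ℂ) (n : ℕ) : ℂ :=
  sigmaTwisted β n q * sigmaC α n * (n : ℂ) ^ (-s) * levelFactor β c n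

theorem normalizedTerm_zero (q c : ℕ) (α β s : ℂ) : normalizedTerm q c α β s 0 = 0 := by
  simp [normalizedTerm, sigmaC]

theorem normalizedTerm_one (q c : ℕ) (α β s : ℂ) : normalizedTerm q c α β s 1 = 1 := by
  simp [normalizedTerm, sigmaC_one, sigmaTwisted_one, levelFactor_one]

theorem normalizedTerm_mul_of_coprime (q c : ℕ) (α β s : ℂ) (m n : ℕ) (hmn : m.Coprime n) :
    normalizedTerm q c α β s (m * n) = normalizedTerm q c α β s m * normalizedTerm q c α β s n := by
  simp only [normalizedTerm, sigmaTwisted_mul_of_coprime β q hmn, sigmaC_mul_of_coprime α hmn,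
    levelFactor_mul_of_coprime β c hmn, Nat.cast_mul, natCast_mul_natCast_cpow]
  ring

section PrimePow

variable {q c p : ℕ} (hp : p.Prime) (α β s : ℂ) (e : ℕ)
include hp

theorem normalizedTerm_prime_pow_of_not_dvd (hcq : c ∣ q) (hpq : ¬ p ∣ q) :
    normalizedTerm q c α β s (p ^ e) =
      (∑ k ∈ Finset.range (e + 1), ((p : ℂ) ^ α) ^ k) *
        (∑ k ∈ Finset.range (e + 1), ((p : ℂ) ^ β) ^ k) * ((p : ℂ) ^ (-s)) ^ e := by
  rw [normalizedTerm, sigmaTwisted_prime_pow_of_not_dvd β hp hpq, natCast_pow_cpow,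
    levelFactor_prime_pow_of_not_dvd β hp fun h => hpq (h.trans hcq), sigmaC_prime_pow α hp,
    sigmaC_prime_pow β hp]
  ring

theorem normalizedTerm_prime_pow_of_dvd_of_not_dvd (hpq : p ∣ q) (hpc : ¬ p ∣ c) :
    normalizedTerm q c α β s (p ^ e) =
      (∑ k ∈ Finset.range (e + 1), ((p : ℂ) ^ α) ^ k) * ((p : ℂ) ^ (-s)) ^ e := by
  rw [normalizedTerm, sigmaTwisted_prime_pow_of_dvd β hp hpq, natCast_pow_cpow,
    levelFactor_prime_pow_of_not_dvd β hp hpc, sigmaC_prime_pow α hp]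
  ring

theorem normalizedTerm_prime_pow_of_dvd (hc : c ≠ 0) (hcq : c ∣ q) (hpc : p ∣ c) :
    normalizedTerm q c α β s (p ^ e) =
      ((1 - (p : ℂ) ^ (β - 1)) * ((∑ k ∈ Finset.range (e + 1), ((p : ℂ) ^ α) ^ k) *
        (∑ k ∈ Finset.range (e + 1), ((p : ℂ) ^ β) ^ k) * ((p : ℂ) ^ (-s)) ^ e) -
        (∑ k ∈ Finset.range (e + 1), ((p : ℂ) ^ α) ^ k) * ((p : ℂ) ^ (-s)) ^ e) /
        (-(p : ℂ) ^ (β - 1)) := by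
  rw [normalizedTerm, sigmaTwisted_prime_pow_of_dvd β hp (hpc.trans hcq), natCast_pow_cpow,
    levelFactor_prime_pow_of_dvd β hc hp hpc, sigmaC_prime_pow α hp, sigmaC_prime_pow β hp]
  ring

end PrimePow

theorem norm_prime_cpow_le {p : ℕ} (hp : p.Prime) (α : ℂ) :
    ‖(p : ℂ) ^ α‖ ≤ (p : ℝ) ^ max 0 α.re := by
  rw [norm_natCast_cpow_of_pos hp.pos]
  exact Real.rpow_le_rpow_of_exponent_le (by exact_mod_cast hp.one_le) (le_max_right _ _)

theorem one_le_prime_rpow_max {p : ℕ} (hp : p.Prime) (x : ℝ) : 1 ≤ (p : ℝ) ^ max 0 x :=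
  Real.one_le_rpow (by exact_mod_cast hp.one_le) (le_max_left _ _)

theorem prime_rpow_max_mul_norm {p : ℕ} (hp : p.Prime) (α β s : ℂ) :
    (p : ℝ) ^ max 0 α.re * (p : ℝ) ^ max 0 β.re * ‖(p : ℂ) ^ (-s)‖ =
      (p : ℝ) ^ (-(s.re - max 0 α.re - max 0 β.re)) := by
  have hp0 : (0 : ℝ) < p := by exact_mod_cast hp.pos
  rw [norm_natCast_cpow_of_pos hp.pos, ← Real.rpow_add hp0, ← Real.rpow_add hp0, neg_re]
  ring_nf

theorem norm_normalizedTerm_prime_pow_le {q c p : ℕ} (hc : c ≠ 0) (hcq : c ∣ q) (hp : p.Prime)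
    (α β s : ℂ) (e : ℕ) :
    ‖normalizedTerm q c α β s (p ^ e)‖ ≤
      (if p ∣ c then (‖1 - (p : ℂ) ^ (β - 1)‖ + 1) / ‖(p : ℂ) ^ (β - 1)‖ else 1) *
        ((e : ℝ) + 1) ^ 2 * ((p : ℝ) ^ (-(s.re - max 0 α.re - max 0 β.re))) ^ e := by
  have ha := norm_geom_sum_le (norm_prime_cpow_le hp α) (one_le_prime_rpow_max hp α.re) e
  have hb := norm_geom_sum_le (norm_prime_cpow_le hp β) (one_le_prime_rpow_max hp β.re) e
  have hB : 1 ≤ ((e : ℝ) + 1) * ((p : ℝ) ^ max 0 β.re) ^ e :=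
    one_le_mul_of_one_le_of_one_le (by simp) (one_le_pow₀ (one_le_prime_rpow_max hp β.re))
  have hR : ((e : ℝ) + 1) ^ 2 * ((p : ℝ) ^ (-(s.re - max 0 α.re - max 0 β.re))) ^ e =
      (((e : ℝ) + 1) * ((p : ℝ) ^ max 0 α.re) ^ e) *
        (((e : ℝ) + 1) * ((p : ℝ) ^ max 0 β.re) ^ e) * ‖(p : ℂ) ^ (-s)‖ ^ e := by
    rw [← prime_rpow_max_mul_norm hp, mul_pow, mul_pow]
    ring
  rw [mul_assoc, hR]
  set u := ∑ k ∈ Finset.range (e + 1), ((p : ℂ) ^ α) ^ k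
  set w := ∑ k ∈ Finset.range (e + 1), ((p : ℂ) ^ β) ^ k
  set A := ((e : ℝ) + 1) * ((p : ℝ) ^ max 0 α.re) ^ e
  set B := ((e : ℝ) + 1) * ((p : ℝ) ^ max 0 β.re) ^ e
  have hA0 : 0 ≤ A := (norm_nonneg _).trans ha
  have hUW : ‖u * w * ((p : ℂ) ^ (-s)) ^ e‖ ≤ A * B * ‖(p : ℂ) ^ (-s)‖ ^ e := by
    rw [norm_mul, norm_mul, norm_pow]
    gcongr
  have hU : ‖u * ((p : ℂ) ^ (-s)) ^ e‖ ≤ A * B * ‖(p : ℂ) ^ (-s)‖ ^ e := by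
    rw [norm_mul, norm_pow]
    gcongr
    exact ha.trans (le_mul_of_one_le_right hA0 hB)
  split_ifs with hpc
  · rw [normalizedTerm_prime_pow_of_dvd hp α β s e hc hcq hpc, norm_div, norm_neg,
      div_mul_eq_mul_div]
    gcongr
    refine (norm_sub_le _ _).trans ?_
    rw [norm_mul, add_mul, one_mul]
    gcongr
  · rw [one_mul]
    by_cases hpq : p ∣ q
    · rwa [normalizedTerm_prime_pow_of_dvd_of_not_dvd hp α β s e hpq hpc]
    · rwa [normalizedTerm_prime_pow_of_not_dvd hp α β s e hcq hpq]

theorem summable_norm_normalizedTerm {q c : ℕ} (hc : c ≠ 0) (hcq : c ∣ q) {α β s : ℂ}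
    (hs : 1 < s.re - max 0 α.re - max 0 β.re) : Summable (‖normalizedTerm q c α β s ·‖) :=
  summable_norm_of_prime_pow_le (S := c.divisors) (normalizedTerm_zero q c α β s)
    (normalizedTerm_one q c α β s) (normalizedTerm_mul_of_coprime q c α β s) hs
    (fun p hp => by rw [if_neg fun h => hp (Nat.mem_divisors.2 ⟨h, hc⟩)])
    fun _ hp e => norm_normalizedTerm_prime_pow_le hc hcq hp α β s e

theorem hasProd_primes_ite_dvd {n : ℕ} (hn : n ≠ 0) (h : ℕ → ℂ) :
    HasProd (fun p : Nat.Primes => if (p : ℕ) ∣ n then h p else 1) (∏ p ∈ n.primeFactors, h p) := by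
  change HasProd ((fun p : ℕ => if p ∣ n then h p else 1) ∘ ((↑) : {p : ℕ | p.Prime} → ℕ)) _
  rw [hasProd_subtype_iff_mulIndicator]
  have hprod : ∏ p ∈ n.primeFactors, h p = ∏ p ∈ n.primeFactors,
      Set.mulIndicator {p : ℕ | p.Prime} (fun p => if p ∣ n then h p else 1) p := by
    refine Finset.prod_congr rfl fun p hp => ?_
    rw [Set.mulIndicator_of_mem (show p ∈ {p : ℕ | p.Prime} from Nat.prime_of_mem_primeFactors hp),
      if_pos (Nat.dvd_of_mem_primeFactors hp)]
  rw [hprod]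
  refine hasProd_prod_of_ne_finset_one fun p hp => ?_
  by_cases hpp : p.Prime
  · rw [Set.mulIndicator_of_mem (show p ∈ {p : ℕ | p.Prime} from hpp),
      if_neg fun h => hp (Nat.mem_primeFactors.2 ⟨hpp, h, hn⟩)]
  · exact Set.mulIndicator_of_notMem hpp _

theorem tsum_normalizedTerm_prime_pow {c d p : ℕ} (hq : Squarefree (c * d)) (hp : p.Prime)
    {α β s : ℂ} (hs : 1 < s.re - max 0 α.re - max 0 β.re) :
    (∑' e : ℕ, normalizedTerm (c * d) c α β s (p ^ e)) * (1 - (p : ℂ) ^ (-(2 * s - β - α)))⁻¹ =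
      (1 - (p : ℂ) ^ (-s))⁻¹ * (1 - (p : ℂ) ^ (-(s - β)))⁻¹ * (1 - (p : ℂ) ^ (-(s - α)))⁻¹ *
        (1 - (p : ℂ) ^ (-(s - β - α)))⁻¹ *
        (if p ∣ c * d then (1 - (p : ℂ) ^ (-(2 * s - β - α)))⁻¹ else 1) *
        (if p ∣ d then (1 - (p : ℂ) ^ (-(s - β))) * (1 - (p : ℂ) ^ (-(s - β - α))) else 1) *
        (if p ∣ c then ((1 - (p : ℂ) ^ (β - 1)) * (1 - (p : ℂ) ^ (-(2 * s - β - α))) -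
          (1 - (p : ℂ) ^ (-(s - β))) * (1 - (p : ℂ) ^ (-(s - β - α)))) /
            (-(p : ℂ) ^ (β - 1)) else 1) := by
  have hp0 : (p : ℂ) ≠ 0 := by exact_mod_cast hp.ne_zero
  have hc : c ≠ 0 := left_ne_zero_of_mul hq.ne_zero
  have e1 : (p : ℂ) ^ (-(s - β)) = (p : ℂ) ^ β * (p : ℂ) ^ (-s) := by
    rw [← cpow_add _ _ hp0]; ring_nf
  have e2 : (p : ℂ) ^ (-(s - α)) = (p : ℂ) ^ α * (p : ℂ) ^ (-s) := by
    rw [← cpow_add _ _ hp0]; ring_nf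
  have e3 : (p : ℂ) ^ (-(s - β - α)) = (p : ℂ) ^ α * (p : ℂ) ^ β * (p : ℂ) ^ (-s) := by
    rw [← cpow_add _ _ hp0, ← cpow_add _ _ hp0]; ring_nf
  have e4 : (p : ℂ) ^ (-(2 * s - β - α)) = (p : ℂ) ^ α * (p : ℂ) ^ β * ((p : ℂ) ^ (-s)) ^ 2 := by
    rw [sq, ← cpow_add _ _ hp0, ← cpow_add _ _ hp0, ← cpow_add _ _ hp0]; ring_nf
  have hA := norm_prime_cpow_le hp α
  have hB := norm_prime_cpow_le hp β
  have hA1 := one_le_prime_rpow_max hp α.re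
  have hB1 := one_le_prime_rpow_max hp β.re
  have hx : (p : ℝ) ^ max 0 α.re * (p : ℝ) ^ max 0 β.re * ‖(p : ℂ) ^ (-s)‖ < 1 := by
    rw [prime_rpow_max_mul_norm hp]
    exact Real.rpow_lt_one_of_one_lt_of_neg (by exact_mod_cast hp.one_lt) (by linarith)
  have hUW := hasSum_geom_sum_mul_geom_sum_mul_pow hA hB hA1 hB1 hx
  have hxA : (p : ℝ) ^ max 0 α.re * ‖(p : ℂ) ^ (-s)‖ < 1 := lt_of_le_of_lt (by
    gcongr; exact le_mul_of_one_le_right (by positivity) hB1) hx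
  have hxB : (p : ℝ) ^ max 0 β.re * ‖(p : ℂ) ^ (-s)‖ < 1 := lt_of_le_of_lt (by
    gcongr; exact le_mul_of_one_le_left (by positivity) hA1) hx
  have hU := hasSum_geom_sum_mul_pow hA hA1 hxA
  have hx1 : ‖(p : ℂ) ^ (-s)‖ < 1 := (le_mul_of_one_le_left (norm_nonneg _) hA1).trans_lt hxA
  have n1 := one_sub_ne_zero_of_norm_lt_one hx1
  have n2 : 1 - (p : ℂ) ^ β * (p : ℂ) ^ (-s) ≠ 0 := by
    refine one_sub_ne_zero_of_norm_lt_one ?_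
    rw [norm_mul]
    exact (by gcongr : _ ≤ (p : ℝ) ^ max 0 β.re * ‖(p : ℂ) ^ (-s)‖).trans_lt hxB
  have n3 : 1 - (p : ℂ) ^ α * (p : ℂ) ^ β * (p : ℂ) ^ (-s) ≠ 0 := by
    refine one_sub_ne_zero_of_norm_lt_one ?_
    rw [norm_mul, norm_mul]
    exact (by gcongr :
      _ ≤ (p : ℝ) ^ max 0 α.re * (p : ℝ) ^ max 0 β.re * ‖(p : ℂ) ^ (-s)‖).trans_lt hx
  have n4 : 1 - (p : ℂ) ^ α * (p : ℂ) ^ β * ((p : ℂ) ^ (-s)) ^ 2 ≠ 0 := by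
    refine one_sub_ne_zero_of_norm_lt_one ?_
    rw [norm_mul, norm_mul, norm_pow]
    refine lt_of_le_of_lt ?_ hx
    gcongr
    exact pow_le_of_le_one (norm_nonneg _) hx1.le two_ne_zero
  have hcancel (u v w : ℂ) (hv : v ≠ 0) (hw : w ≠ 0) : u = u * v⁻¹ * w⁻¹ * (v * w) := by
    field_simp
  rw [hcancel (_ * _) _ _ n2 n3] at hU
  rw [e1, e2, e3, e4]
  by_cases hpq : p ∣ c * d
  · by_cases hpc : p ∣ c
    · have hpd : ¬ p ∣ d := fun hpd =>
        hp.one_lt.ne' (Nat.isUnit_iff.1 (hq p (mul_dvd_mul hpc hpd)))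
      simp only [normalizedTerm_prime_pow_of_dvd hp α β s _ hc (dvd_mul_right c d) hpc]
      rw [(((hUW.mul_left _).sub hU).div_const _).tsum_eq, if_pos hpq, if_neg hpd, if_pos hpc]
      ring
    · have hpd : p ∣ d := (hp.dvd_mul.1 hpq).resolve_left hpc
      simp only [normalizedTerm_prime_pow_of_dvd_of_not_dvd hp α β s _ hpq hpc]
      rw [hU.tsum_eq, if_pos hpq, if_pos hpd, if_neg hpc]
      ring
  · have hpc : ¬ p ∣ c := fun h => hpq (h.mul_right d)
    have hpd : ¬ p ∣ d := fun h => hpq (h.mul_left c)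
    simp only [normalizedTerm_prime_pow_of_not_dvd hp α β s _ (dvd_mul_right c d) hpq]
    rw [hUW.tsum_eq, if_neg hpq, if_neg hpd, if_neg hpc]
    field_simp

theorem tsum_normalizedTerm {c d : ℕ} (hq : Squarefree (c * d)) {α β s : ℂ}
    (hs : 1 < s.re - max 0 α.re - max 0 β.re) :
    (∑' n : ℕ, normalizedTerm (c * d) c α β s n) * riemannZeta (2 * s - β - α) =
      riemannZeta s * riemannZeta (s - β) * riemannZeta (s - α) * riemannZeta (s - β - α) *
        (∏ p ∈ (c * d).primeFactors, (1 - (p : ℂ) ^ (-(2 * s - β - α)))⁻¹) *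
        (∏ p ∈ d.primeFactors,
          (1 - (p : ℂ) ^ (-(s - β))) * (1 - (p : ℂ) ^ (-(s - β - α)))) *
        ∏ p ∈ c.primeFactors, ((1 - (p : ℂ) ^ (β - 1)) * (1 - (p : ℂ) ^ (-(2 * s - β - α))) -
          (1 - (p : ℂ) ^ (-(s - β))) * (1 - (p : ℂ) ^ (-(s - β - α)))) /
            (-(p : ℂ) ^ (β - 1)) := by
  have hc : c ≠ 0 := left_ne_zero_of_mul hq.ne_zero
  have hd : d ≠ 0 := right_ne_zero_of_mul hq.ne_zero
  have hα0 := le_max_left 0 α.re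
  have hα := le_max_right 0 α.re
  have hβ0 := le_max_left 0 β.re
  have hβ := le_max_right 0 β.re
  have hL := (EulerProduct.eulerProduct_hasProd (normalizedTerm_one (c * d) c α β s)
    (fun {m n} => normalizedTerm_mul_of_coprime (c * d) c α β s m n)
    (summable_norm_normalizedTerm hc (dvd_mul_right c d) hs)
    (normalizedTerm_zero (c * d) c α β s)).mul
    (riemannZeta_eulerProduct_hasProd (s := 2 * s - β - α) (by simp; linarith))
  have hR := ((((((riemannZeta_eulerProduct_hasProd (s := s) (by linarith)).mul
    (riemannZeta_eulerProduct_hasProd (s := s - β) (by simp; linarith))).mul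
    (riemannZeta_eulerProduct_hasProd (s := s - α) (by simp; linarith))).mul
    (riemannZeta_eulerProduct_hasProd (s := s - β - α) (by simp; linarith))).mul
    (hasProd_primes_ite_dvd hq.ne_zero fun p => (1 - (p : ℂ) ^ (-(2 * s - β - α)))⁻¹)).mul
    (hasProd_primes_ite_dvd hd fun p =>
      (1 - (p : ℂ) ^ (-(s - β))) * (1 - (p : ℂ) ^ (-(s - β - α))))).mul
    (hasProd_primes_ite_dvd hc fun p =>
      ((1 - (p : ℂ) ^ (β - 1)) * (1 - (p : ℂ) ^ (-(2 * s - β - α))) -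
        (1 - (p : ℂ) ^ (-(s - β))) * (1 - (p : ℂ) ^ (-(s - β - α)))) / (-(p : ℂ) ^ (β - 1)))
  refine hL.unique ?_
  convert hR using 2 with p
  exact tsum_normalizedTerm_prime_pow hq p.2 hs

/-- Evaluation of the Dirichlet series
`∑_n σ_β(n;χ_q) σ_α(n) n^{-s} ∏_{p ∣ c₁} (σ_β(n_p)(1-p^{β-1}) - 1)` for a squarefree
level `q = c₁·d₁`. -/
theorem local_factor_sigma_series_eval (q c₁ d₁ : ℕ) (hq : Squarefree q)
    (hc₁ : 0 < c₁) (hd₁ : 0 < d₁) (hfac : q = c₁ * d₁) (α β s : ℂ)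
    (hs : 1 + max 0 (max α.re (max β.re (α + β).re)) < s.re) :
    (∑' n : ℕ+,
      sigmaTwisted β n q * sigmaC α n * (n : ℂ) ^ (-s) *
        ∏ p ∈ c₁.primeFactors,
          (sigmaC β (p ^ (n : ℕ).factorization p) * (1 - (p : ℂ) ^ (β - 1)) - 1))
    = riemannZeta s * riemannZeta (s - β) * riemannZeta (s - α) * riemannZeta (s - β - α) /
        riemannZeta (2 * s - β - α) *
        (∏ p ∈ q.primeFactors, (1 - (p : ℂ) ^ (-(2 * s - β - α)))⁻¹) *
        (∏ p ∈ d₁.primeFactors,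
          (1 - (p : ℂ) ^ (-(s - β))) * (1 - (p : ℂ) ^ (-(s - β - α)))) *
        (∏ p ∈ c₁.primeFactors,
          ((1 - (p : ℂ) ^ (β - 1)) * (1 - (p : ℂ) ^ (-(2 * s - β - α))) -
            (1 - (p : ℂ) ^ (-(s - β))) * (1 - (p : ℂ) ^ (-(s - β - α))))) := by
  subst hfac
  have hs' : 1 < s.re - max 0 α.re - max 0 β.re := by
    rw [add_re] at hs
    rcases max_cases 0 α.re with h | h <;> rcases max_cases 0 β.re with h' | h' <;>
      rcases max_cases β.re (α.re + β.re) with h₁ | h₁ <;>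
      rcases max_cases α.re (max β.re (α.re + β.re)) with h₂ | h₂ <;>
      rcases max_cases 0 (max α.re (max β.re (α.re + β.re))) with h₃ | h₃ <;> linarith
  have hζ : riemannZeta (2 * s - β - α) ≠ 0 := by
    refine riemannZeta_ne_zero_of_one_lt_re ?_
    have hα0 := le_max_left 0 α.re
    have hα := le_max_right 0 α.re
    have hβ0 := le_max_left 0 β.re
    have hβ := le_max_right 0 β.re
    simp only [sub_re, mul_re, re_ofNat, im_ofNat]
    linarith
  have hP : ∏ p ∈ c₁.primeFactors, (-(p : ℂ) ^ (β - 1)) ≠ 0 :=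
    Finset.prod_ne_zero_iff.2 fun p hp =>
      neg_ne_zero.2 (natCast_prime_cpow_ne_zero (Nat.prime_of_mem_primeFactors hp) _)
  have hterm (n : ℕ) : sigmaTwisted β n (c₁ * d₁) * sigmaC α n * (n : ℂ) ^ (-s) *
      ∏ p ∈ c₁.primeFactors,
        (sigmaC β (p ^ n.factorization p) * (1 - (p : ℂ) ^ (β - 1)) - 1) =
      (∏ p ∈ c₁.primeFactors, (-(p : ℂ) ^ (β - 1))) * normalizedTerm (c₁ * d₁) c₁ α β s n := by
    rw [normalizedTerm, levelFactor, Finset.prod_div_distrib]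
    field_simp
  have htsum : ∑' n : ℕ+, normalizedTerm (c₁ * d₁) c₁ α β s n =
      ∑' n : ℕ, normalizedTerm (c₁ * d₁) c₁ α β s n := by
    refine PNat.coe_injective.tsum_eq fun n hn => ?_
    refine ⟨⟨n, Nat.pos_of_ne_zero ?_⟩, rfl⟩
    rintro rfl
    exact hn (normalizedTerm_zero _ _ _ _ _)
  simp only [hterm]
  rw [tsum_mul_left, htsum, eq_div_of_mul_eq hζ (tsum_normalizedTerm hq hs'),
    Finset.prod_div_distrib (s := c₁.primeFactors)]
  field_simp
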